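/- arXiv:2412.05017 — 6 statements merged into one kernel-verified Lean document; each statement's English description precedes it below -/
import Mathlib

section
/- Let a_1,…,a_n be positive integers with Σ_{i=1}^n a_i = 2C. If there exists a subset A ⊆ {1,…,n} with Σ_{i∈A} a_i = C, then there exists a feasible solution to DLSPp whose cost is at most n + C (namely, remanufacture x_i = a_i, y_i = 0 in each period i ∈ A and manufacture x_i = 0, y_i = a_i in each period i ∉ A). -/
/-- Core level `J i` determined by returns `R` and remanufacturing decisions `x`:
`J 1 = R 1`, `J (i+1) = J i + R (i+1) - x i`. -/
def coreLevel (R x : ℕ → ℤ) : ℕ → ℤ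
  | 0 => 0
  | 1 => R 1
  | (i + 2) => coreLevel R x (i + 1) + R (i + 2) - x (i + 1)

/-- Serviceable inventory level `I i`: `I 1 = 0`, `I (i+1) = I i + x i + y i - D i`. -/
def servLevel (D x y : ℕ → ℤ) : ℕ → ℤ
  | 0 => 0
  | 1 => 0
  | (i + 2) => servLevel D x y (i + 1) + x (i + 1) + y (i + 1) - D (i + 1)

/-- Feasibility of `(x, y)` for the dynamic lot sizing problem with `N` periods,
demands `D` and returns `R`. -/
def Feasible (N : ℕ) (D R x y : ℕ → ℤ) : Prop :=
  ∀ i : ℕ, 1 ≤ i → i ≤ N →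
    0 ≤ x i ∧ 0 ≤ y i ∧ x i ≤ coreLevel R x i ∧ 0 ≤ servLevel D x y (i + 1)

/-- Total cost of a solution `(x, y)` of the dynamic lot sizing problem. -/
def cost (N : ℕ) (D R Kr Km hs hc cr cm x y : ℕ → ℤ) : ℤ :=
  ∑ i ∈ Finset.Icc 1 N,
    (Kr i * (if 0 < x i then 1 else 0) + Km i * (if 0 < y i then 1 else 0)
      + cr i * x i + cm i * y i + hc i * (coreLevel R x i - x i)
      + hs i * servLevel D x y (i + 1))

/-- Returns for the DLSPp instance: `R 1 = C`, `R i = 0` for `i ≠ 1`. -/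
def ppR (C : ℤ) : ℕ → ℤ := fun i => if i = 1 then C else 0

theorem coreLevel_ppR_succ (C : ℤ) (x : ℕ → ℤ) (i : ℕ) :
    coreLevel (ppR C) x (i + 1) = C - ∑ j ∈ Finset.Icc 1 i, x j := by
  induction i with
  | zero => simp [coreLevel, ppR]
  | succ i ih =>
    rw [coreLevel, ih, Finset.sum_Icc_succ_top (by omega)]
    simp only [ppR, show i + 2 ≠ 1 by omega, if_false]
    ring

/-- Producing exactly the demand in every period keeps the serviceable inventory empty. -/
theorem servLevel_eq_zero {D x y : ℕ → ℤ} (h : ∀ i, x i + y i = D i) (i : ℕ) :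
    servLevel D x y i = 0 := by
  induction i with
  | zero => rfl
  | succ i ih =>
    cases i with
    | zero => rfl
    | succ i =>
      rw [servLevel, ih]
      linarith [h (i + 1)]

/-- If the partition instance has a solution `A`, then remanufacturing `a i` in periods
`i ∈ A` and manufacturing `a i` in periods `i ∉ A` is feasible for DLSPp with cost at
most `n + C`. -/
theorem stmt0 (n : ℕ) (hn : 1 ≤ n) (a : ℕ → ℤ) (C : ℤ)
    (ha : ∀ i : ℕ, 1 ≤ i → i ≤ n → 0 < a i)
    (hsum : ∑ i ∈ Finset.Icc 1 n, a i = 2 * C)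
    (A : Finset ℕ) (hA : A ⊆ Finset.Icc 1 n)
    (hAsum : ∑ i ∈ A, a i = C) :
    Feasible n a (ppR C) (fun i => if i ∈ A then a i else 0)
      (fun i => if i ∈ A then 0 else a i) ∧
    cost n a (ppR C) (fun _ => 1) (fun _ => 1) (fun _ => 3) (fun _ => 0) (fun _ => 0)
      (fun _ => 1) (fun i => if i ∈ A then a i else 0) (fun i => if i ∈ A then 0 else a i)
      ≤ (n : ℤ) + C := by
  have hserv : ∀ i, servLevel a (fun i => if i ∈ A then a i else 0)
      (fun i => if i ∈ A then 0 else a i) i = 0 :=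
    servLevel_eq_zero fun i => by split_ifs <;> simp
  have hx : ∑ i ∈ Finset.Icc 1 n, (if i ∈ A then a i else 0) = C := by
    rw [Finset.sum_ite_mem, Finset.inter_eq_right.mpr hA, hAsum]
  have hx_nonneg : ∀ i ∈ Finset.Icc 1 n, 0 ≤ if i ∈ A then a i else 0 := by
    intro i hi
    rw [Finset.mem_Icc] at hi
    split_ifs
    exacts [(ha i hi.1 hi.2).le, le_rfl]
  refine ⟨fun i h1 hi => ⟨hx_nonneg i (Finset.mem_Icc.mpr ⟨h1, hi⟩), ?_, ?_, (hserv _).ge⟩, ?_⟩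
  · dsimp only
    split_ifs
    exacts [le_rfl, (ha i h1 hi).le]
  · obtain ⟨i, rfl⟩ := Nat.exists_eq_add_of_le' h1
    rw [coreLevel_ppR_succ, le_sub_iff_add_le', ← Finset.sum_Icc_succ_top (by omega)]
    refine (Finset.sum_le_sum_of_subset_of_nonneg (Finset.Icc_subset_Icc_right hi)
      fun j hj _ => hx_nonneg j hj).trans hx.le
  · have hterm : ∀ i ∈ Finset.Icc 1 n,
        ((if 0 < (if i ∈ A then a i else 0) then 1 else 0)
          + (if 0 < (if i ∈ A then 0 else a i) then 1 else 0)
          + (if i ∈ A then 0 else a i) : ℤ) = 1 + (a i - if i ∈ A then a i else 0) := by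
      intro i hi
      rw [Finset.mem_Icc] at hi
      have := ha i hi.1 hi.2
      by_cases h : i ∈ A <;> simp [h, this]
    simp only [cost, hserv, one_mul, zero_mul, mul_zero, add_zero]
    rw [Finset.sum_congr rfl hterm, Finset.sum_add_distrib, Finset.sum_sub_distrib, hsum, hx]
    simp only [Finset.sum_const, Nat.card_Icc, Nat.add_sub_cancel, nsmul_eq_mul, mul_one]
    linarith
end

section
/- Let a_1,…,a_n be positive integers with Σ_{i=1}^n a_i = 2C. Then every optimal solution of DLSPp has cost at least n + C; equivalently, the infimum of the costs of feasible solutions to DLSPp is at least n + C. -/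
theorem servLevel_succ_eq_sum (D x y : ℕ → ℤ) (k : ℕ) :
    servLevel D x y (k + 1) = ∑ i ∈ Finset.Icc 1 k, (x i + y i - D i) := by
  induction k with
  | zero => simp [servLevel]
  | succ k ih =>
    rw [Finset.sum_Icc_succ_top (by omega), ← ih]
    simp only [servLevel]
    ring

theorem coreLevel_ppR_succ_eq (C : ℤ) (x : ℕ → ℤ) (k : ℕ) :
    coreLevel (ppR C) x (k + 1) = C - ∑ i ∈ Finset.Icc 1 k, x i := by
  induction k with
  | zero => simp [coreLevel, ppR]
  | succ k ih =>
    rw [Finset.sum_Icc_succ_top (by omega)]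
    simp only [coreLevel, ih]
    simp [ppR]
    ring

/-- Every period without a setup is served from stock held in the preceding period. -/
theorem le_sum_setup_add_holding (n : ℕ) (D R x y : ℕ → ℤ)
    (hD : ∀ i : ℕ, 1 ≤ i → i ≤ n → 0 < D i) (h : Feasible n D R x y) (k : ℕ) (hk : k ≤ n) :
    (k : ℤ) + servLevel D x y (k + 1) ≤
      ∑ i ∈ Finset.Icc 1 k, ((if 0 < x i then 1 else 0) + (if 0 < y i then 1 else 0)
        + 3 * servLevel D x y (i + 1)) := by
  induction k with
  | zero => simp [servLevel]
  | succ k ih =>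
    have hprev : 0 ≤ servLevel D x y (k + 1) := by
      rcases k with _ | k
      · simp [servLevel]
      · exact (h (k + 1) (by omega) (by omega)).2.2.2
    obtain ⟨hx, hy, -, hI⟩ := h (k + 1) (by omega) hk
    have hDk := hD (k + 1) (by omega) hk
    have hstep : servLevel D x y (k + 1 + 1) =
        servLevel D x y (k + 1) + x (k + 1) + y (k + 1) - D (k + 1) := rfl
    have ih' := ih (by omega)
    rw [Finset.sum_Icc_succ_top (by omega)]
    push_cast
    split_ifs <;> omega

/-- Every feasible solution of DLSPp has cost at least `n + C`; in particular every
optimal solution does, and the infimum of the costs is at least `n + C`. -/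
theorem stmt1 (n : ℕ) (hn : 1 ≤ n) (a : ℕ → ℤ) (C : ℤ)
    (ha : ∀ i : ℕ, 1 ≤ i → i ≤ n → 0 < a i)
    (hsum : ∑ i ∈ Finset.Icc 1 n, a i = 2 * C) :
    ∀ x y : ℕ → ℤ, Feasible n a (ppR C) x y →
      (n : ℤ) + C ≤ cost n a (ppR C) (fun _ => 1) (fun _ => 1) (fun _ => 3) (fun _ => 0)
        (fun _ => 0) (fun _ => 1) x y := by
  intro x y h
  have hsetup := le_sum_setup_add_holding n a (ppR C) x y ha h n le_rfl
  have hI := (h n hn le_rfl).2.2.2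
  have hserv := servLevel_succ_eq_sum a x y n
  rw [Finset.sum_sub_distrib, Finset.sum_add_distrib, hsum] at hserv
  have hx : ∑ i ∈ Finset.Icc 1 n, x i ≤ C := by
    obtain ⟨m, rfl⟩ : ∃ m, n = m + 1 := ⟨n - 1, by omega⟩
    have hcore := (h (m + 1) hn le_rfl).2.2.1
    rw [coreLevel_ppR_succ_eq] at hcore
    rw [Finset.sum_Icc_succ_top (by omega)]
    linarith
  have hcost : cost n a (ppR C) (fun _ => 1) (fun _ => 1) (fun _ => 3) (fun _ => 0)
      (fun _ => 0) (fun _ => 1) x y =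
      ∑ i ∈ Finset.Icc 1 n, ((if 0 < x i then 1 else 0) + (if 0 < y i then 1 else 0)
        + 3 * servLevel a x y (i + 1)) + ∑ i ∈ Finset.Icc 1 n, y i := by
    rw [cost, ← Finset.sum_add_distrib]
    exact Finset.sum_congr rfl fun i _ => by ring
  linarith
end

section
/- Consider a DLSP whose parameters satisfy Assumption 1, and let (x*, y*) be an optimal solution with associated core levels J* and serviceable inventory levels I*. If production occurs in the i-th period for some 1 ≤ i ≤ N − 1 (that is, x*_i + y*_i ≥ 1), then I*_{i+1} = 0. -/
/-- The sequence `z` with one unit moved from position `i` to position `i + 1`. -/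
def postpone (i : ℕ) (z : ℕ → ℤ) (j : ℕ) : ℤ :=
  z j + (if j = i + 1 then 1 else 0) - (if j = i then 1 else 0)

theorem coreLevel_postpone {i : ℕ} (hi : 1 ≤ i) (R x : ℕ → ℤ) :
    ∀ j, coreLevel R (postpone i x) j = coreLevel R x j + if j = i + 1 then 1 else 0
  | 0 => by simp [coreLevel]
  | 1 => by simp [coreLevel, show i ≠ 0 by omega]
  | j + 2 => by
    simp only [coreLevel, coreLevel_postpone hi R x (j + 1), postpone]
    split_ifs <;> omega

theorem servLevel_postpone_left {i : ℕ} (hi : 1 ≤ i) (D x y : ℕ → ℤ) :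
    ∀ j, servLevel D (postpone i x) y j = servLevel D x y j - if j = i + 1 then 1 else 0
  | 0 => by simp [servLevel]
  | 1 => by simp [servLevel, show i ≠ 0 by omega]
  | j + 2 => by
    simp only [servLevel, servLevel_postpone_left hi D x y (j + 1), postpone]
    split_ifs <;> omega

theorem servLevel_swap (D x y : ℕ → ℤ) : ∀ j, servLevel D x y j = servLevel D y x j
  | 0 => rfl
  | 1 => rfl
  | j + 2 => by
    simp only [servLevel, servLevel_swap D x y (j + 1)]
    ring

theorem servLevel_postpone_right {i : ℕ} (hi : 1 ≤ i) (D x y : ℕ → ℤ) (j : ℕ) :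
    servLevel D x (postpone i y) j = servLevel D x y j - if j = i + 1 then 1 else 0 := by
  rw [servLevel_swap, servLevel_postpone_left hi, servLevel_swap]

theorem Feasible.postpone_left {N i : ℕ} {D R x y : ℕ → ℤ} (h : Feasible N D R x y)
    (hi : 1 ≤ i) (hx : 0 < x i) (hI : 0 < servLevel D x y (i + 1)) :
    Feasible N D R (postpone i x) y := by
  intro j hj hjN
  obtain ⟨h1, h2, h3, h4⟩ := h j hj hjN
  rw [coreLevel_postpone hi, servLevel_postpone_left hi]
  simp only [postpone]
  rcases eq_or_ne j i with rfl | hne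
  · simp
    omega
  · refine ⟨?_, h2, ?_, ?_⟩ <;>
      simp only [hne, Nat.add_right_cancel_iff, if_false] <;> omega

theorem Feasible.postpone_right {N i : ℕ} {D R x y : ℕ → ℤ} (h : Feasible N D R x y)
    (hi : 1 ≤ i) (hy : 0 < y i) (hI : 0 < servLevel D x y (i + 1)) :
    Feasible N D R x (postpone i y) := by
  intro j hj hjN
  obtain ⟨h1, h2, h3, h4⟩ := h j hj hjN
  rw [servLevel_postpone_right hi]
  simp only [postpone]
  rcases eq_or_ne j i with rfl | hne
  · simp
    omega
  · refine ⟨h1, ?_, h3, ?_⟩ <;>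
      simp only [hne, Nat.add_right_cancel_iff, if_false] <;> omega

/-- A sum over `Icc 1 N` whose terms increase by at most `a` at `i + 1` and `b` at `i`. -/
theorem sum_Icc_le_add_of_le_add_ite {N i : ℕ} {f g : ℕ → ℤ} {a b : ℤ} (hi : 1 ≤ i)
    (hiN : i + 1 ≤ N)
    (h : ∀ j ∈ Finset.Icc 1 N,
      f j ≤ g j + (if j = i + 1 then a else 0) + (if j = i then b else 0)) :
    ∑ j ∈ Finset.Icc 1 N, f j ≤ ∑ j ∈ Finset.Icc 1 N, g j + a + b := by
  refine (Finset.sum_le_sum h).trans_eq ?_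
  rw [Finset.sum_add_distrib, Finset.sum_add_distrib, Finset.sum_ite_eq', Finset.sum_ite_eq',
    if_pos (Finset.mem_Icc.2 ⟨by omega, hiN⟩), if_pos (Finset.mem_Icc.2 ⟨hi, by omega⟩)]

/-- Setup cost bound for a quantity that grows by one unit. -/
theorem setup_add_one_le {K : ℤ} (hK : 0 ≤ K) (z : ℤ) :
    K * (if 0 < z + 1 then 1 else 0) ≤ K * (if 0 < z then 1 else 0) + K := by
  split_ifs <;> linarith

theorem setup_sub_one_le {K : ℤ} (hK : 0 ≤ K) (z : ℤ) :
    K * (if 0 < z - 1 then 1 else 0) ≤ K * (if 0 < z then 1 else 0) := by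
  split_ifs <;> linarith

theorem cost_postpone_left_le {N i : ℕ} (D R Kr Km hs hc cr cm x y : ℕ → ℤ)
    (hKr : ∀ j : ℕ, 1 ≤ j → j ≤ N → 0 ≤ Kr j) (hi : 1 ≤ i) (hiN : i + 1 ≤ N) :
    cost N D R Kr Km hs hc cr cm (postpone i x) y ≤
      cost N D R Kr Km hs hc cr cm x y + (Kr (i + 1) + cr (i + 1)) + (hc i - hs i - cr i) := by
  refine sum_Icc_le_add_of_le_add_ite hi hiN fun j hj => ?_
  rw [Finset.mem_Icc] at hj
  have hK := hKr j hj.1 hj.2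
  rw [coreLevel_postpone hi, servLevel_postpone_left hi]
  rcases eq_or_ne j i with rfl | hne
  · simp only [postpone, Nat.left_eq_add, one_ne_zero, if_true, if_false, add_zero]
    linarith [setup_sub_one_le hK (x j)]
  rcases eq_or_ne j (i + 1) with rfl | hne'
  · simp only [postpone, Nat.add_eq_left, one_ne_zero, if_true, if_false, sub_zero, add_zero]
    linarith [setup_add_one_le hK (x (i + 1))]
  · simp [postpone, hne, hne']

theorem cost_postpone_right_le {N i : ℕ} (D R Kr Km hs hc cr cm x y : ℕ → ℤ)
    (hKm : ∀ j : ℕ, 1 ≤ j → j ≤ N → 0 ≤ Km j) (hi : 1 ≤ i) (hiN : i + 1 ≤ N) :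
    cost N D R Kr Km hs hc cr cm x (postpone i y) ≤
      cost N D R Kr Km hs hc cr cm x y + (Km (i + 1) + cm (i + 1)) + (-hs i - cm i) := by
  refine sum_Icc_le_add_of_le_add_ite hi hiN fun j hj => ?_
  rw [Finset.mem_Icc] at hj
  have hK := hKm j hj.1 hj.2
  rw [servLevel_postpone_right hi]
  rcases eq_or_ne j i with rfl | hne
  · simp only [postpone, Nat.left_eq_add, one_ne_zero, if_true, if_false, add_zero]
    linarith [setup_sub_one_le hK (y j)]
  rcases eq_or_ne j (i + 1) with rfl | hne'
  · simp only [postpone, Nat.add_eq_left, one_ne_zero, if_true, if_false, sub_zero, add_zero]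
    linarith [setup_add_one_le hK (y (i + 1))]
  · simp [postpone, hne, hne']

/-- Zero-inventory property: for a DLSP satisfying Assumption 1, if an optimal solution
produces in period `i` with `1 ≤ i ≤ N - 1`, then `I*_{i+1} = 0`. -/
theorem stmt4 (N : ℕ) (hN : 1 ≤ N) (D R Kr Km hs hc cr cm : ℕ → ℤ)
    (hD : ∀ i : ℕ, 1 ≤ i → i ≤ N → 0 < D i)
    (hR : ∀ i : ℕ, 1 ≤ i → i ≤ N → 0 ≤ R i)
    (hKr : ∀ i : ℕ, 1 ≤ i → i ≤ N → 0 ≤ Kr i)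
    (hKm : ∀ i : ℕ, 1 ≤ i → i ≤ N → 0 ≤ Km i)
    (hhs : ∀ i : ℕ, 1 ≤ i → i ≤ N → 0 ≤ hs i)
    (hhc : ∀ i : ℕ, 1 ≤ i → i ≤ N → 0 ≤ hc i)
    (hcr : ∀ i : ℕ, 1 ≤ i → i ≤ N → 0 ≤ cr i)
    (hcm : ∀ i : ℕ, 1 ≤ i → i ≤ N → 0 ≤ cm i)
    (hRN : R (N + 1) = 0) (hKrN : Kr (N + 1) = 0) (hKmN : Km (N + 1) = 0)
    (hcrN : cr (N + 1) = 0) (hcmN : cm (N + 1) = 0)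
    (hass1 : ∀ i : ℕ, 1 ≤ i → i ≤ N → Km (i + 1) + cm (i + 1) < hs i + cm i)
    (hass2 : ∀ i : ℕ, 1 ≤ i → i ≤ N → Kr (i + 1) + hc i + cr (i + 1) < hs i + cr i)
    (x y : ℕ → ℤ)
    (hfeas : Feasible N D R x y)
    (hopt : ∀ x' y' : ℕ → ℤ, Feasible N D R x' y' →
      cost N D R Kr Km hs hc cr cm x y ≤ cost N D R Kr Km hs hc cr cm x' y')
    (i : ℕ) (hi1 : 1 ≤ i) (hi2 : i ≤ N - 1)
    (hprod : 1 ≤ x i + y i) :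
    servLevel D x y (i + 1) = 0 := by
  have hiN : i + 1 ≤ N := by omega
  have hnonneg := (hfeas i hi1 (by omega)).2.2.2
  by_contra hne
  have hI : 0 < servLevel D x y (i + 1) := lt_of_le_of_ne hnonneg (Ne.symm hne)
  rcases (show 0 < x i ∨ 0 < y i by omega) with hx | hy
  · linarith [hopt _ _ (hfeas.postpone_left hi1 hx hI), hass2 i hi1 (by omega),
      cost_postpone_left_le D R Kr Km hs hc cr cm x y hKr hi1 hiN]
  · linarith [hopt _ _ (hfeas.postpone_right hi1 hy hI), hass1 i hi1 (by omega),
      cost_postpone_right_le D R Kr Km hs hc cr cm x y hKm hi1 hiN]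
end

section
/- Consider a DLSP whose parameters satisfy Assumption 1. Then the infimum C* of the costs of feasible solutions to the DLSP equals C**_1(R_1), the value of the dynamic program at initial core level J_1 = R_1. -/
/-- Auxiliary dynamic program value, with fuel `k` corresponding to period `i = N + 1 - k`:
`dpAux N … 0 J = 0` and for `k + 1` (period `i = N - k`) the minimum over
`0 ≤ x ≤ min (J, D i)` of the one-period cost plus `dpAux … k (J - x + R (i+1))`. -/
noncomputable def dpAux (N : ℕ) (D R Kr Km hc cr cm : ℕ → ℤ) : ℕ → ℤ → ℤ
  | 0, _ => 0
  | (k + 1), J =>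
      sInf {c : ℤ | ∃ x : ℤ, 0 ≤ x ∧ x ≤ J ∧ x ≤ D (N - k) ∧
        c = Kr (N - k) * (if 0 < x then 1 else 0)
            + Km (N - k) * (if 0 < D (N - k) - x then 1 else 0)
            + hc (N - k) * (J - x) + cr (N - k) * x + cm (N - k) * (D (N - k) - x)
            + dpAux N D R Kr Km hc cr cm k (J - x + R (N - k + 1))}

/-- The dynamic program value `C**_i(J)` for the dynamic lot sizing problem:
`dp N … (N+1) J = 0` and, for `1 ≤ i ≤ N`,
`dp N … i J = min over 0 ≤ x ≤ min (J, D i) of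
[K_{r,i}·𝟙(x>0) + ΔK_{m,i}·𝟙(D_i-x>0) + h_{c,i}(J-x) + c_{r,i}x + c_{m,i}(D_i-x)
  + dp N … (i+1) (J - x + R (i+1))]`. -/
noncomputable def dp (N : ℕ) (D R Kr Km hc cr cm : ℕ → ℤ) (i : ℕ) (J : ℤ) : ℤ :=
  dpAux N D R Kr Km hc cr cm (N + 1 - i) J

/-- Cost of period `i` with core level `J` before remanufacturing, decisions `x`, `y`, and
serviceable inventory `I` at the end of the period. -/
def periodCost (Kr Km hs hc cr cm : ℕ → ℤ) (i : ℕ) (J I x y : ℤ) : ℤ :=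
  Kr i * (if 0 < x then 1 else 0) + Km i * (if 0 < y then 1 else 0)
    + cr i * x + cm i * y + hc i * (J - x) + hs i * I

/-- `AchievableCost … k J I c`: from core level `J` and serviceable inventory `I`, the cost of the
last `k` periods can be made equal to `c`. -/
def AchievableCost (N : ℕ) (D R Kr Km hs hc cr cm : ℕ → ℤ) : ℕ → ℤ → ℤ → ℤ → Prop
  | 0, _, _, c => c = 0
  | k + 1, J, I, c => ∃ x y c' : ℤ, 0 ≤ x ∧ 0 ≤ y ∧ x ≤ J ∧ 0 ≤ I + x + y - D (N - k) ∧
      AchievableCost N D R Kr Km hs hc cr cm k (J + R (N - k + 1) - x) (I + x + y - D (N - k)) c' ∧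
      c = periodCost Kr Km hs hc cr cm (N - k) J (I + x + y - D (N - k)) x y + c'

section

variable {N : ℕ} {D R Kr Km hs hc cr cm : ℕ → ℤ}

theorem periodCost_nonneg {i : ℕ} {J I x y : ℤ} (hKr : 0 ≤ Kr i) (hKm : 0 ≤ Km i)
    (hhs : 0 ≤ hs i) (hhc : 0 ≤ hc i) (hcr : 0 ≤ cr i) (hcm : 0 ≤ cm i)
    (hx : 0 ≤ x) (hy : 0 ≤ y) (hJ : x ≤ J) (hI : 0 ≤ I) :
    0 ≤ periodCost Kr Km hs hc cr cm i J I x y := by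
  have hJx : 0 ≤ J - x := by omega
  unfold periodCost
  positivity

theorem mul_indicator_add_le {K a x : ℤ} (hK : 0 ≤ K) (hx : 0 ≤ x) :
    K * (if 0 < x + a then 1 else 0) ≤
      K * (if 0 < x then 1 else 0) + K * (if 0 < a then 1 else 0) := by
  split_ifs <;> omega

theorem mul_indicator_le_mul {K a : ℤ} (hK : 0 ≤ K) (ha : 0 ≤ a) :
    K * (if 0 < a then 1 else 0) ≤ K * a := by
  split_ifs <;> nlinarith

theorem mul_indicator_mono {K a b : ℤ} (hK : 0 ≤ K) (h : a ≤ b) :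
    K * (if 0 < a then 1 else 0) ≤ K * (if 0 < b then 1 else 0) := by
  split_ifs <;> omega

/-- Serviceable inventory that would have been carried into a period can instead be produced in
that period, at the additional unit and setup costs of that period. -/
theorem AchievableCost.postpone (hKr : ∀ i, 1 ≤ i → i ≤ N → 0 ≤ Kr i)
    (hKm : ∀ i, 1 ≤ i → i ≤ N → 0 ≤ Km i)
    (hKrN : Kr (N + 1) = 0) (hKmN : Km (N + 1) = 0) (hcrN : cr (N + 1) = 0)
    (hcmN : cm (N + 1) = 0) {k : ℕ} (hk : k ≤ N) {J a b c : ℤ} (ha : 0 ≤ a) (hb : 0 ≤ b)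
    (h : AchievableCost N D R Kr Km hs hc cr cm k J (a + b) c) :
    ∃ c', AchievableCost N D R Kr Km hs hc cr cm k (J + a) 0 c' ∧
      c' ≤ c + Kr (N - k + 1) * (if 0 < a then 1 else 0) + cr (N - k + 1) * a
        + Km (N - k + 1) * (if 0 < b then 1 else 0) + cm (N - k + 1) * b := by
  cases k with
  | zero =>
    refine ⟨0, rfl, ?_⟩
    have hc0 : c = 0 := h
    simp [hc0, hKrN, hKmN, hcrN, hcmN]
  | succ k =>
    obtain ⟨x, y, c', hx, hy, hxJ, hI, hrest, rfl⟩ := h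
    have hi : N - (k + 1) + 1 = N - k := by omega
    rw [hi]
    have hI' : 0 + (x + a) + (y + b) - D (N - k) = a + b + x + y - D (N - k) := by ring
    have hJ' : J + a + R (N - k + 1) - (x + a) = J + R (N - k + 1) - x := by ring
    refine ⟨_, ⟨x + a, y + b, c', by omega, by omega, by omega, by omega, ?_, rfl⟩, ?_⟩
    · rw [hI', hJ']
      exact hrest
    · rw [hI']
      have h1 := mul_indicator_add_le (a := a) (hKr (N - k) (by omega) (by omega)) hx
      have h2 := mul_indicator_add_le (a := b) (hKm (N - k) (by omega) (by omega)) hy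
      unfold periodCost
      linarith

/-- The recursive step of `dpAux` in terms of `periodCost`. -/
theorem dpAux_succ (k : ℕ) (J : ℤ) :
    dpAux N D R Kr Km hc cr cm (k + 1) J =
      sInf {c : ℤ | ∃ x : ℤ, 0 ≤ x ∧ x ≤ J ∧ x ≤ D (N - k) ∧
        c = periodCost Kr Km 0 hc cr cm (N - k) J 0 x (D (N - k) - x)
            + dpAux N D R Kr Km hc cr cm k (J + R (N - k + 1) - x)} := by
  rw [dpAux]
  refine congrArg sInf (Set.ext fun c => exists_congr fun x => ?_)
  have hJ : J - x + R (N - k + 1) = J + R (N - k + 1) - x := by ring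
  rw [hJ]
  constructor <;> rintro ⟨h1, h2, h3, rfl⟩ <;> refine ⟨h1, h2, h3, ?_⟩ <;>
    simp only [periodCost, Pi.zero_apply] <;> ring

theorem dpAux_nonneg (hKr : ∀ i, 1 ≤ i → i ≤ N → 0 ≤ Kr i)
    (hKm : ∀ i, 1 ≤ i → i ≤ N → 0 ≤ Km i) (hhc : ∀ i, 1 ≤ i → i ≤ N → 0 ≤ hc i)
    (hcr : ∀ i, 1 ≤ i → i ≤ N → 0 ≤ cr i) (hcm : ∀ i, 1 ≤ i → i ≤ N → 0 ≤ cm i)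
    {k : ℕ} (hk : k ≤ N) (J : ℤ) : 0 ≤ dpAux N D R Kr Km hc cr cm k J := by
  induction k generalizing J with
  | zero => exact le_rfl
  | succ k ih =>
    rw [dpAux_succ]
    rcases Set.eq_empty_or_nonempty {c : ℤ | ∃ x : ℤ, 0 ≤ x ∧ x ≤ J ∧ x ≤ D (N - k) ∧
        c = periodCost Kr Km 0 hc cr cm (N - k) J 0 x (D (N - k) - x)
            + dpAux N D R Kr Km hc cr cm k (J + R (N - k + 1) - x)} with hempty | hne
    · rw [hempty, Int.csInf_empty]
    refine le_csInf hne ?_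
    rintro _ ⟨x, hx, hxJ, hxD, rfl⟩
    have h1 : 1 ≤ N - k := by omega
    have h2 : N - k ≤ N := by omega
    exact add_nonneg (periodCost_nonneg (hKr _ h1 h2) (hKm _ h1 h2) le_rfl (hhc _ h1 h2)
      (hcr _ h1 h2) (hcm _ h1 h2) hx (by omega) hxJ le_rfl) (ih (by omega) _)

theorem bddBelow_dpAux_candidates (hKr : ∀ i, 1 ≤ i → i ≤ N → 0 ≤ Kr i)
    (hKm : ∀ i, 1 ≤ i → i ≤ N → 0 ≤ Km i) (hhc : ∀ i, 1 ≤ i → i ≤ N → 0 ≤ hc i)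
    (hcr : ∀ i, 1 ≤ i → i ≤ N → 0 ≤ cr i) (hcm : ∀ i, 1 ≤ i → i ≤ N → 0 ≤ cm i)
    {k : ℕ} (hk : k + 1 ≤ N) (J : ℤ) :
    BddBelow {c : ℤ | ∃ x : ℤ, 0 ≤ x ∧ x ≤ J ∧ x ≤ D (N - k) ∧
        c = periodCost Kr Km 0 hc cr cm (N - k) J 0 x (D (N - k) - x)
            + dpAux N D R Kr Km hc cr cm k (J + R (N - k + 1) - x)} := by
  refine ⟨0, ?_⟩
  rintro _ ⟨x, hx, hxJ, hxD, rfl⟩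
  have h1 : 1 ≤ N - k := by omega
  have h2 : N - k ≤ N := by omega
  exact add_nonneg (periodCost_nonneg (hKr _ h1 h2) (hKm _ h1 h2) le_rfl (hhc _ h1 h2)
    (hcr _ h1 h2) (hcm _ h1 h2) hx (by omega) hxJ le_rfl)
    (dpAux_nonneg hKr hKm hhc hcr hcm (by omega) _)

/-- The dynamic program value is attained by a solution carrying no serviceables. -/
theorem achievableCost_dpAux (hD : ∀ i, 1 ≤ i → i ≤ N → 0 < D i)
    (hR : ∀ i, 1 ≤ i → i ≤ N → 0 ≤ R i) (hRN : R (N + 1) = 0)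
    (hKr : ∀ i, 1 ≤ i → i ≤ N → 0 ≤ Kr i)
    (hKm : ∀ i, 1 ≤ i → i ≤ N → 0 ≤ Km i) (hhc : ∀ i, 1 ≤ i → i ≤ N → 0 ≤ hc i)
    (hcr : ∀ i, 1 ≤ i → i ≤ N → 0 ≤ cr i) (hcm : ∀ i, 1 ≤ i → i ≤ N → 0 ≤ cm i)
    {k : ℕ} (hk : k ≤ N) {J : ℤ} (hJ : 0 ≤ J) :
    AchievableCost N D R Kr Km hs hc cr cm k J 0 (dpAux N D R Kr Km hc cr cm k J) := by
  induction k generalizing J with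
  | zero => rfl
  | succ k ih =>
    have hDk := hD (N - k) (by omega) (by omega)
    have hbdd := bddBelow_dpAux_candidates (D := D) (R := R) hKr hKm hhc hcr hcm hk J
    have hmem := Int.csInf_mem (by exact ⟨_, 0, le_rfl, hJ, hDk.le, rfl⟩) hbdd
    rw [← dpAux_succ] at hmem
    obtain ⟨x, hx, hxJ, hxD, hval⟩ := hmem
    have hRk : 0 ≤ R (N - k + 1) := by
      rcases Nat.eq_zero_or_pos k with rfl | hk0
      · exact hRN.ge
      · exact hR _ (by omega) (by omega)
    have hI : 0 + x + (D (N - k) - x) - D (N - k) = 0 := by ring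
    refine ⟨x, D (N - k) - x, dpAux N D R Kr Km hc cr cm k (J + R (N - k + 1) - x), hx, by omega,
      hxJ, hI.ge, ?_, hval.trans ?_⟩
    · rw [hI]
      exact ih (by omega) (by omega)
    · rw [hI]
      simp [periodCost]

/-- Under the cost assumptions, no solution starting without serviceables beats the dynamic
program. -/
theorem AchievableCost.dpAux_le (hD : ∀ i, 1 ≤ i → i ≤ N → 0 < D i)
    (hKr : ∀ i, 1 ≤ i → i ≤ N → 0 ≤ Kr i)
    (hKm : ∀ i, 1 ≤ i → i ≤ N → 0 ≤ Km i) (hhc : ∀ i, 1 ≤ i → i ≤ N → 0 ≤ hc i)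
    (hcr : ∀ i, 1 ≤ i → i ≤ N → 0 ≤ cr i) (hcm : ∀ i, 1 ≤ i → i ≤ N → 0 ≤ cm i)
    (hKrN : Kr (N + 1) = 0) (hKmN : Km (N + 1) = 0)
    (hcrN : cr (N + 1) = 0) (hcmN : cm (N + 1) = 0)
    (hass1 : ∀ i, 1 ≤ i → i ≤ N → Km (i + 1) + cm (i + 1) < hs i + cm i)
    (hass2 : ∀ i, 1 ≤ i → i ≤ N → Kr (i + 1) + hc i + cr (i + 1) < hs i + cr i)
    {k : ℕ} (hk : k ≤ N) {J c : ℤ} (h : AchievableCost N D R Kr Km hs hc cr cm k J 0 c) :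
    dpAux N D R Kr Km hc cr cm k J ≤ c := by
  induction k generalizing J c with
  | zero => exact le_of_eq (Eq.symm h)
  | succ k ih =>
    obtain ⟨x, y, c', hx, hy, hxJ, hI, hrest, rfl⟩ := h
    have hi1 : 1 ≤ N - k := by omega
    have hi2 : N - k ≤ N := by omega
    have hDk := hD (N - k) hi1 hi2
    obtain ⟨a, b, hab, ha, hb, hax, hby⟩ : ∃ a b : ℤ,
        0 + x + y - D (N - k) = a + b ∧ 0 ≤ a ∧ 0 ≤ b ∧ a ≤ x ∧ b ≤ y :=
      ⟨min (x + y - D (N - k)) x, x + y - D (N - k) - min (x + y - D (N - k)) x,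
        by omega, by omega, by omega, by omega, by omega⟩
    rw [hab] at hrest ⊢
    obtain ⟨c'', hc'', hle⟩ :=
      hrest.postpone hKr hKm hKrN hKmN hcrN hcmN (by omega) ha hb
    have hdp := ih (by omega) hc''
    have hcand := csInf_le (bddBelow_dpAux_candidates (D := D) (R := R) hKr hKm hhc hcr hcm hk J)
      ⟨x - a, by omega, by omega, by omega, rfl⟩
    rw [← dpAux_succ] at hcand
    have hJ' : J + R (N - k + 1) - (x - a) = J + R (N - k + 1) - x + a := by ring
    have hy' : D (N - k) - (x - a) = y - b := by linarith
    rw [hJ', hy'] at hcand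
    have hKr' : 0 ≤ Kr (N - k + 1) := by
      rcases Nat.eq_zero_or_pos k with rfl | hk0
      · exact hKrN.ge
      · exact hKr _ (by omega) (by omega)
    have hKm' : 0 ≤ Km (N - k + 1) := by
      rcases Nat.eq_zero_or_pos k with rfl | hk0
      · exact hKmN.ge
      · exact hKm _ (by omega) (by omega)
    have h1 := mul_indicator_le_mul hKr' ha
    have h2 := mul_indicator_le_mul hKm' hb
    have h3 := mul_le_mul_of_nonneg_right (hass2 _ hi1 hi2).le ha
    have h4 := mul_le_mul_of_nonneg_right (hass1 _ hi1 hi2).le hb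
    have h5 := mul_indicator_mono (hKr _ hi1 hi2) (sub_le_self x ha)
    have h6 := mul_indicator_mono (hKm _ hi1 hi2) (sub_le_self y hb)
    simp only [periodCost, Pi.zero_apply] at hcand ⊢
    linarith

theorem Feasible.achievableCost {x y : ℕ → ℤ} (h : Feasible N D R x y) {k : ℕ} (hk : k ≤ N) :
    AchievableCost N D R Kr Km hs hc cr cm k (coreLevel R x (N - k + 1))
      (servLevel D x y (N - k + 1))
      (∑ i ∈ Finset.Ioc (N - k) N,
        periodCost Kr Km hs hc cr cm i (coreLevel R x i) (servLevel D x y (i + 1)) (x i) (y i)) := by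
  induction k with
  | zero => simp [AchievableCost]
  | succ k ih =>
    obtain ⟨m, hm⟩ : ∃ m, N - k = m + 1 := ⟨N - k - 1, by omega⟩
    have hm' : N - (k + 1) = m := by omega
    have ih := ih (by omega)
    obtain ⟨h1, h2, h3, h4⟩ := h (m + 1) (by omega) (by omega)
    rw [hm']
    rw [hm] at ih
    refine ⟨x (m + 1), y (m + 1), ∑ i ∈ Finset.Ioc (m + 1) N,
      periodCost Kr Km hs hc cr cm i (coreLevel R x i) (servLevel D x y (i + 1)) (x i) (y i),
      h1, h2, h3, ?_, ?_, ?_⟩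
    · rw [hm]
      exact h4
    · rw [hm]
      exact ih
    · rw [hm, ← Finset.insert_Ioc_add_one_left_eq_Ioc (by omega), Finset.sum_insert (by simp)]
      rfl

/-- An achievable cost of the last `k` periods is realized by explicit sequences of decisions and
inventory levels. -/
theorem AchievableCost.exists_trajectory {k : ℕ} (hk : k ≤ N) {J I c : ℤ}
    (h : AchievableCost N D R Kr Km hs hc cr cm k J I c) :
    ∃ x y X S : ℕ → ℤ, X (N - k + 1) = J ∧ S (N - k + 1) = I ∧
      (∀ i, N - k < i → i ≤ N → 0 ≤ x i ∧ 0 ≤ y i ∧ x i ≤ X i ∧ 0 ≤ S (i + 1) ∧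
        X (i + 1) = X i + R (i + 1) - x i ∧ S (i + 1) = S i + x i + y i - D i) ∧
      ∑ i ∈ Finset.Ioc (N - k) N,
        periodCost Kr Km hs hc cr cm i (X i) (S (i + 1)) (x i) (y i) = c := by
  induction k generalizing J I c with
  | zero =>
    have hc0 : c = 0 := h
    exact ⟨0, 0, fun _ => J, fun _ => I, rfl, rfl, by intros; omega, by simp [hc0]⟩
  | succ k ih =>
    obtain ⟨x₀, y₀, c', hx, hy, hxJ, hI, hrest, rfl⟩ := h
    obtain ⟨x, y, X, S, hX, hS, htraj, hsum⟩ := ih (by omega) hrest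
    obtain ⟨m, hm⟩ : ∃ m, N - k = m + 1 := ⟨N - k - 1, by omega⟩
    have hm' : N - (k + 1) = m := by omega
    rw [hm']
    rw [hm] at hX hS htraj hsum hI
    refine ⟨Function.update x (m + 1) x₀, Function.update y (m + 1) y₀,
      Function.update X (m + 1) J, Function.update S (m + 1) I, by simp, by simp, ?_, ?_⟩
    · intro i hi hiN
      rcases eq_or_ne i (m + 1) with rfl | hne
      · simp only [Function.update_self, Function.update_of_ne (Nat.succ_ne_self (m + 1))]
        exact ⟨hx, hy, hxJ, hS ▸ hI, hX, hS⟩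
      · have hne' : i + 1 ≠ m + 1 := by omega
        simp only [Function.update_of_ne hne, Function.update_of_ne hne']
        exact htraj i (by omega) hiN
    · rw [← Finset.insert_Ioc_add_one_left_eq_Ioc (by omega), Finset.sum_insert (by simp),
        ← hsum, hm]
      congr 1
      · simp [hS]
      · refine Finset.sum_congr rfl fun i hi => ?_
        have hi' := (Finset.mem_Ioc.mp hi).1
        have hne : i ≠ m + 1 := by omega
        have hne' : i + 1 ≠ m + 1 := by omega
        simp only [Function.update_of_ne hne, Function.update_of_ne hne']

theorem AchievableCost.exists_feasible {c : ℤ}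
    (h : AchievableCost N D R Kr Km hs hc cr cm N (R 1) 0 c) :
    ∃ x y : ℕ → ℤ, Feasible N D R x y ∧ cost N D R Kr Km hs hc cr cm x y = c := by
  obtain ⟨x, y, X, S, hX, hS, htraj, hsum⟩ := h.exists_trajectory le_rfl
  simp only [Nat.sub_self, Nat.zero_add] at hX hS htraj hsum
  have key : ∀ i, i ≤ N → coreLevel R x (i + 1) = X (i + 1) ∧
      servLevel D x y (i + 1) = S (i + 1) := by
    intro i
    induction i with
    | zero => exact fun _ => ⟨hX.symm, hS.symm⟩
    | succ i ih =>
      intro hi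
      obtain ⟨ih1, ih2⟩ := ih (by omega)
      obtain ⟨-, -, -, -, h5, h6⟩ := htraj (i + 1) (by omega) hi
      rw [coreLevel, servLevel, ih1, ih2, h5, h6]
      exact ⟨rfl, rfl⟩
  have hcore : ∀ i, 1 ≤ i → i ≤ N → coreLevel R x i = X i := by
    intro i h1 h2
    obtain ⟨j, rfl⟩ : ∃ j, i = j + 1 := ⟨i - 1, by omega⟩
    exact (key j (by omega)).1
  refine ⟨x, y, fun i h1 h2 => ?_, ?_⟩
  · obtain ⟨g1, g2, g3, g4, -, -⟩ := htraj i h1 h2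
    rw [hcore i h1 h2, (key i h2).2]
    exact ⟨g1, g2, g3, g4⟩
  · rw [← hsum]
    refine Finset.sum_congr rfl fun i hi => ?_
    obtain ⟨h1, h2⟩ := Finset.mem_Icc.mp hi
    rw [hcore i h1 h2, (key i h2).2, periodCost]

end

/-- For a DLSP satisfying Assumption 1, the infimum `C*` of the costs of feasible
solutions equals the dynamic program value `C**_1(R_1)`. -/
theorem stmt7 (N : ℕ) (hN : 1 ≤ N) (D R Kr Km hs hc cr cm : ℕ → ℤ)
    (hD : ∀ i : ℕ, 1 ≤ i → i ≤ N → 0 < D i)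
    (hR : ∀ i : ℕ, 1 ≤ i → i ≤ N → 0 ≤ R i)
    (hKr : ∀ i : ℕ, 1 ≤ i → i ≤ N → 0 ≤ Kr i)
    (hKm : ∀ i : ℕ, 1 ≤ i → i ≤ N → 0 ≤ Km i)
    (hhs : ∀ i : ℕ, 1 ≤ i → i ≤ N → 0 ≤ hs i)
    (hhc : ∀ i : ℕ, 1 ≤ i → i ≤ N → 0 ≤ hc i)
    (hcr : ∀ i : ℕ, 1 ≤ i → i ≤ N → 0 ≤ cr i)
    (hcm : ∀ i : ℕ, 1 ≤ i → i ≤ N → 0 ≤ cm i)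
    (hRN : R (N + 1) = 0) (hKrN : Kr (N + 1) = 0) (hKmN : Km (N + 1) = 0)
    (hcrN : cr (N + 1) = 0) (hcmN : cm (N + 1) = 0)
    (hass1 : ∀ i : ℕ, 1 ≤ i → i ≤ N → Km (i + 1) + cm (i + 1) < hs i + cm i)
    (hass2 : ∀ i : ℕ, 1 ≤ i → i ≤ N → Kr (i + 1) + hc i + cr (i + 1) < hs i + cr i)
    :
    sInf {c : ℤ | ∃ x y : ℕ → ℤ, Feasible N D R x y ∧
        cost N D R Kr Km hs hc cr cm x y = c} =
      dp N D R Kr Km hc cr cm 1 (R 1) := by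
  have hset : {c : ℤ | ∃ x y : ℕ → ℤ, Feasible N D R x y ∧
      cost N D R Kr Km hs hc cr cm x y = c} =
      {c | AchievableCost N D R Kr Km hs hc cr cm N (R 1) 0 c} := by
    ext c
    constructor
    · rintro ⟨x, y, hxy, rfl⟩
      have h := hxy.achievableCost (Kr := Kr) (Km := Km) (hs := hs) (hc := hc) (cr := cr)
        (cm := cm) le_rfl
      rw [Nat.sub_self] at h
      exact h
    · exact AchievableCost.exists_feasible
  rw [hset, dp, Nat.add_sub_cancel]
  refine IsLeast.csInf_eq ⟨achievableCost_dpAux hD hR hRN hKr hKm hhc hcr hcm le_rfl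
    (hR 1 le_rfl hN), fun c h => ?_⟩
  exact h.dpAux_le hD hKr hKm hhc hcr hcm hKrN hKmN hcrN hcmN hass1 hass2 le_rfl
end

section
/- Fix an integer N ≥ 1, demands D_1,…,D_N ∈ ℤ with D_i > 0, and returns R_1,…,R_N ∈ ℤ with R_i ≥ 0 (and R_{N+1} = 0). Define L_2 = (R_1 − D_1)^+ and L_{k+1} = (L_k + R_k − D_k)^+ for 2 ≤ k ≤ N − 1, where t^+ = max(t, 0). Let x_1, …, x_{N} be nonnegative integers and define J_1 = R_1 and J_{k+1} = J_k − x_k + R_{k+1}, and suppose x_k ≤ min(J_k, D_k) for all k. Then for every 2 ≤ i ≤ N one has L_i ≤ J_i − R_i ≤ R_1 + R_2 + ⋯ + R_{i−1}. -/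
/-- Lower bounds `L i` for the shifted core levels: `L 2 = (R 1 - D 1)⁺` and
`L (k+1) = (L k + R k - D k)⁺` for `k ≥ 2`. -/
def Llev (D R : ℕ → ℤ) : ℕ → ℤ
  | 0 => 0
  | 1 => 0
  | 2 => max (R 1 - D 1) 0
  | (k + 3) => max (Llev D R (k + 2) + R (k + 2) - D (k + 2)) 0

/-- The core-level states arising in the dynamic program satisfy
`L i ≤ J i - R i ≤ R 1 + ⋯ + R (i-1)` for all `2 ≤ i ≤ N`. -/
theorem stmt8 (N : ℕ) (hN : 1 ≤ N) (D R : ℕ → ℤ)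
    (hD : ∀ i : ℕ, 1 ≤ i → i ≤ N → 0 < D i)
    (hR : ∀ i : ℕ, 1 ≤ i → i ≤ N → 0 ≤ R i)
    (hRN : R (N + 1) = 0)
    (x : ℕ → ℤ)
    (hx0 : ∀ k : ℕ, 1 ≤ k → k ≤ N → 0 ≤ x k)
    (hx1 : ∀ k : ℕ, 1 ≤ k → k ≤ N → x k ≤ min (coreLevel R x k) (D k))
    (i : ℕ) (hi1 : 2 ≤ i) (hi2 : i ≤ N) :
    Llev D R i ≤ coreLevel R x i - R i ∧
      coreLevel R x i - R i ≤ ∑ k ∈ Finset.Icc 1 (i - 1), R k := by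
  induction i, hi1 using Nat.le_induction with
  | base =>
    have h0 := hx0 1 le_rfl hN
    obtain ⟨hJ, hxD⟩ := le_min_iff.mp (hx1 1 le_rfl hN)
    simp only [coreLevel] at hJ
    simp only [Llev, coreLevel, zero_add, Nat.add_one_sub_one, Finset.Icc_self, Finset.sum_singleton]
    omega
  | succ k hk ih =>
    obtain ⟨hlow, hupp⟩ := ih (by omega)
    obtain ⟨m, rfl⟩ := Nat.exists_eq_add_of_le' hk
    have h0 := hx0 (m + 2) (by omega) (by omega)
    obtain ⟨hJ, hxD⟩ := le_min_iff.mp (hx1 (m + 2) (by omega) (by omega))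
    have hcore : coreLevel R x (m + 2 + 1) =
        coreLevel R x (m + 2) + R (m + 2 + 1) - x (m + 2) := rfl
    have hL : Llev D R (m + 2 + 1) =
        max (Llev D R (m + 2) + R (m + 2) - D (m + 2)) 0 := rfl
    have hsum : ∑ k ∈ Finset.Icc 1 (m + 2 + 1 - 1), R k =
        ∑ k ∈ Finset.Icc 1 (m + 2 - 1), R k + R (m + 2) :=
      Finset.sum_Icc_succ_top (by omega) R
    rw [hcore, hL, hsum]
    omega
end

section
/- Consider the DLSPp instance of DLSP and its dynamic program C**. Then for every i = 1,…,n and every integer J ≥ 0, C**_i(J) = min{ 𝟙(min(D_i, J) > 0) + 𝟙(D_i − min(D_i, J) > 0) + (D_i − min(D_i, J)) + C**_{i+1}(J − min(D_i, J)), 1 + D_i + C**_{i+1}(J) }; that is, the minimum in the dynamic programming recursion is attained either at x = min(D_i, J) or at x = 0. -/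
/-- The infimum in the recursion of `dpAux` is a minimum. -/
theorem dpAux_succ_isLeast (N : ℕ) (D R Kr Km hc cr cm : ℕ → ℤ) (k : ℕ) (J : ℤ)
    (hJ : 0 ≤ J) (hD : 0 ≤ D (N - k)) :
    IsLeast {c : ℤ | ∃ x : ℤ, 0 ≤ x ∧ x ≤ J ∧ x ≤ D (N - k) ∧
        c = Kr (N - k) * (if 0 < x then 1 else 0)
            + Km (N - k) * (if 0 < D (N - k) - x then 1 else 0)
            + hc (N - k) * (J - x) + cr (N - k) * x + cm (N - k) * (D (N - k) - x)
            + dpAux N D R Kr Km hc cr cm k (J - x + R (N - k + 1))}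
      (dpAux N D R Kr Km hc cr cm (k + 1) J) := by
  rw [dpAux]
  set S := {c : ℤ | ∃ x : ℤ, 0 ≤ x ∧ x ≤ J ∧ x ≤ D (N - k) ∧
        c = Kr (N - k) * (if 0 < x then 1 else 0)
            + Km (N - k) * (if 0 < D (N - k) - x then 1 else 0)
            + hc (N - k) * (J - x) + cr (N - k) * x + cm (N - k) * (D (N - k) - x)
            + dpAux N D R Kr Km hc cr cm k (J - x + R (N - k + 1))} with hS
  have hfin : S.Finite := by
    refine ((Set.finite_Icc (0 : ℤ) J).image fun x =>
      Kr (N - k) * (if 0 < x then 1 else 0)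
            + Km (N - k) * (if 0 < D (N - k) - x then 1 else 0)
            + hc (N - k) * (J - x) + cr (N - k) * x + cm (N - k) * (D (N - k) - x)
            + dpAux N D R Kr Km hc cr cm k (J - x + R (N - k + 1))).subset ?_
    rintro c ⟨x, h0, hxJ, -, rfl⟩
    exact ⟨x, ⟨h0, hxJ⟩, rfl⟩
  have hne : S.Nonempty := ⟨_, 0, le_rfl, hJ, hD, rfl⟩
  exact ⟨Int.csInf_mem hne hfin.bddBelow, fun c hc => csInf_le hfin.bddBelow hc⟩

/-- The cost-to-go function of the DLSPp instance with `k` periods left. -/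
noncomputable def ppDP (n : ℕ) (a : ℕ → ℤ) (C : ℤ) (k : ℕ) (J : ℤ) : ℤ :=
  dpAux n a (ppR C) (fun _ => 1) (fun _ => 1) (fun _ => 0) (fun _ => 0) (fun _ => 1) k J

theorem ppDP_succ_isLeast (n : ℕ) (a : ℕ → ℤ) (C : ℤ) {k : ℕ} (hk : k < n)
    (ha : 0 ≤ a (n - k)) {J : ℤ} (hJ : 0 ≤ J) :
    IsLeast {c : ℤ | ∃ x : ℤ, 0 ≤ x ∧ x ≤ J ∧ x ≤ a (n - k) ∧
        c = (if 0 < x then 1 else 0) + (if 0 < a (n - k) - x then 1 else 0)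
            + (a (n - k) - x) + ppDP n a C k (J - x)}
      (ppDP n a C (k + 1) J) := by
  have hR : ppR C (n - k + 1) = 0 := if_neg (by omega)
  simpa [ppDP, hR] using dpAux_succ_isLeast n a (ppR C) (fun _ => 1) (fun _ => 1) (fun _ => 0)
    (fun _ => 0) (fun _ => 1) k J hJ ha

/-- Losing all `y` available cores raises the optimal cost by at most `y`. -/
theorem ppDP_zero_le (n : ℕ) (a : ℕ → ℤ) (C : ℤ) (ha : ∀ i : ℕ, 1 ≤ i → i ≤ n → 0 < a i)
    {k : ℕ} (hk : k ≤ n) {y : ℤ} (hy : 0 ≤ y) :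
    ppDP n a C k 0 ≤ ppDP n a C k y + y := by
  induction k generalizing y with
  | zero => simpa [ppDP, dpAux] using hy
  | succ k ih =>
    have hpos := ha (n - k) (by omega) (by omega)
    obtain ⟨x, h0, hxy, hxa, hx⟩ := (ppDP_succ_isLeast n a C hk hpos.le hy).1
    have hle := (ppDP_succ_isLeast n a C hk hpos.le le_rfl).2
      ⟨0, le_rfl, le_rfl, hpos.le, rfl⟩
    have hrec := ih (by omega) (sub_nonneg.2 hxy)
    simp only [sub_zero] at hle
    split_ifs at hle hx <;> omega

/-- Losing some of the available cores raises the optimal cost by at most their number plus one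
setup. -/
theorem ppDP_le_add (n : ℕ) (a : ℕ → ℤ) (C : ℤ) (ha : ∀ i : ℕ, 1 ≤ i → i ≤ n → 0 < a i)
    {k : ℕ} (hk : k ≤ n) {y z : ℤ} (hz : 0 ≤ z) (hzy : z ≤ y) :
    ppDP n a C k z ≤ ppDP n a C k y + (y - z) + 1 := by
  induction k generalizing y z with
  | zero => simp only [ppDP, dpAux]; omega
  | succ k ih =>
    have hpos := ha (n - k) (by omega) (by omega)
    obtain ⟨x, h0, hxy, hxa, hx⟩ := (ppDP_succ_isLeast n a C hk hpos.le (hz.trans hzy)).1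
    have hlb := (ppDP_succ_isLeast n a C hk hpos.le hz).2
    by_cases hd : y - z < x
    · have hle := hlb ⟨x - (y - z), by omega, by omega, by omega, rfl⟩
      rw [show z - (x - (y - z)) = y - x by ring] at hle
      split_ifs at hle hx <;> omega
    · have hle := hlb ⟨0, le_rfl, hz, hpos.le, rfl⟩
      have hrec := ih (by omega) hz (show z ≤ y - x by omega)
      simp only [sub_zero] at hle
      split_ifs at hle hx <;> omega

/-- For the DLSPp instance, the minimum in the dynamic programming recursion is
attained either at `x = min (D_i, J)` or at `x = 0`:
`C**_i(J) = min { 𝟙(min(D_i,J)>0) + 𝟙(D_i - min(D_i,J)>0) + (D_i - min(D_i,J))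
  + C**_{i+1}(J - min(D_i,J)), 1 + D_i + C**_{i+1}(J) }`. -/
theorem stmt10 (n : ℕ) (hn : 1 ≤ n) (a : ℕ → ℤ) (C : ℤ)
    (ha : ∀ i : ℕ, 1 ≤ i → i ≤ n → 0 < a i)
    (hsum : ∑ i ∈ Finset.Icc 1 n, a i = 2 * C)
    (i : ℕ) (hi1 : 1 ≤ i) (hi2 : i ≤ n) (J : ℤ) (hJ : 0 ≤ J) :
    dp n a (ppR C) (fun _ => 1) (fun _ => 1) (fun _ => 0) (fun _ => 0) (fun _ => 1) i J =
      min
        ((if 0 < min (a i) J then (1 : ℤ) else 0)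
          + (if 0 < a i - min (a i) J then (1 : ℤ) else 0)
          + (a i - min (a i) J)
          + dp n a (ppR C) (fun _ => 1) (fun _ => 1) (fun _ => 0) (fun _ => 0)
              (fun _ => 1) (i + 1) (J - min (a i) J))
        (1 + a i + dp n a (ppR C) (fun _ => 1) (fun _ => 1) (fun _ => 0) (fun _ => 0)
              (fun _ => 1) (i + 1) J) := by
  have hpos := ha i hi1 hi2
  have hsub : n - (n - i) = i := by omega
  have hleast := ppDP_succ_isLeast n a C (k := n - i) (by omega) (by rw [hsub]; exact hpos.le) hJ
  rw [hsub] at hleast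
  obtain ⟨⟨x, h0, hxJ, hxa, hx⟩, hlb⟩ := hleast
  simp only [dp, show n + 1 - i = n - i + 1 by omega, show n + 1 - (i + 1) = n - i by omega]
  simp only [← ppDP.eq_1]
  apply le_antisymm
  · refine le_min (hlb ⟨min (a i) J, by omega, by omega, by omega, rfl⟩) ?_
    have hle := hlb ⟨0, le_rfl, hJ, hpos.le, rfl⟩
    simpa [hpos] using hle
  · rcases h0.eq_or_lt with rfl | hx0
    · exact (min_le_right _ _).trans (by simp [hx, hpos])
    · refine (min_le_left _ _).trans ?_
      rcases (le_min hxa hxJ).eq_or_lt with rfl | hxm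
      · exact hx.ge
      · rcases le_or_gt (a i) J with haJ | haJ
        · have hstep := ppDP_le_add n a C ha (k := n - i) (by omega)
            (sub_nonneg.2 haJ) (show J - a i ≤ J - x by omega)
          rw [min_eq_left haJ]
          split_ifs at hx ⊢ <;> omega
        · have hstep := ppDP_zero_le n a C ha (k := n - i) (by omega) (sub_nonneg.2 hxJ)
          rw [min_eq_right haJ.le, sub_self]
          split_ifs at hx ⊢ <;> omega
end
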